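/- arXiv:q-alg/9708008 — 2 statements merged into one kernel-verified Lean document; each statement's English description precedes it below -/
import Mathlib

section
/- Let F be the fermionic Fock space of the bc-system and L_m (m ∈ ℤ) the modes of T(z) = :∂b(z)c(z): defined in the context. Then the L_m satisfy the Virasoro relations with central charge −2: for all m, n ∈ ℤ, L_m ∘ L_n − L_n ∘ L_m = (m − n)·L_{m+n} − (1/6)(m³ − m)·δ_{m,−n}·id as operators on F. -/
noncomputable section

open ExteriorAlgebra

/-- Index type for the basis of `V`: `Sum.inl n` corresponds to `v_n` (`n ≥ 0`),
and `Sum.inr n` corresponds to `w_{n+1}` (so the `w_k` for `k ≥ 1`). -/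
abbrev BCIndex : Type := ℕ ⊕ ℕ

/-- The vector space `V` with basis `{v_n : n ≥ 0} ∪ {w_n : n ≥ 1}`. -/
abbrev BCSpace : Type := BCIndex →₀ ℂ

/-- The fermionic Fock space: the exterior algebra of `V`. -/
abbrev FockF : Type := ExteriorAlgebra ℂ BCSpace

/-- The basis vector of `V` with index `i`. -/
def bv (i : BCIndex) : BCSpace := Finsupp.single i 1

/-- The linear functional sending the basis vector `i` to `1` and all others to `0`. -/
def bvDual (i : BCIndex) : Module.Dual ℂ BCSpace := Finsupp.lapply i

/-- The operator `b(n)`: for `n ≤ 0` left exterior multiplication by `v_{-n}`,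
for `n ≥ 1` contraction with the functional dual to `w_n`. -/
def bOp (n : ℤ) : Module.End ℂ FockF :=
  if n ≤ 0 then LinearMap.mulLeft ℂ (ι ℂ (bv (Sum.inl (-n).toNat)))
  else CliffordAlgebra.contractLeft (bvDual (Sum.inr (n - 1).toNat))

/-- The operator `c(n)`: for `n ≥ 0` contraction with the functional dual to `v_n`,
for `n ≤ -1` left exterior multiplication by `w_{-n}`. -/
def cOp (n : ℤ) : Module.End ℂ FockF :=
  if 0 ≤ n then CliffordAlgebra.contractLeft (bvDual (Sum.inl n.toNat))
  else LinearMap.mulLeft ℂ (ι ℂ (bv (Sum.inr (-n - 1).toNat)))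

/-- The normally ordered product `:b(k)c(j):`. -/
def nbc (k j : ℤ) : Module.End ℂ FockF :=
  if 1 ≤ k ∧ j ≤ -1 then -(cOp j ∘ₗ bOp k) else bOp k ∘ₗ cOp j

/-- The Virasoro modes `L_m` of `T(z) = :∂b(z)c(z):`,
`L_m x = Σ_k (−k)·:b(k)c(m−k):·x` (a finite sum on each `x`). -/
def Lmode (m : ℤ) (x : FockF) : FockF :=
  ∑ᶠ k : ℤ, (-k : ℂ) • nbc k (m - k) x

/-- The modes `W̃_m` of `W̃(z) = (1/2)(:∂²b(z)c(z): − :∂b(z)∂c(z):)`,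
`W̃_m x = (1/2)Σ_k k(2k−m)·:b(k)c(m−k):·x` (a finite sum on each `x`). -/
def Wmode (m : ℤ) (x : FockF) : FockF :=
  ∑ᶠ k : ℤ, ((1 / 2 : ℂ) * k * (2 * k - m)) • nbc k (m - k) x

/-- The charge of a list of basis indices: (number of `v`-type) − (number of `w`-type). -/
def chargeOf (L : List BCIndex) : ℤ :=
  (L.countP Sum.isLeft : ℤ) - (L.countP Sum.isRight : ℤ)

/-- `F^l`: the span of the wedge monomials of charge `l`. -/
def FF (l : ℤ) : Submodule ℂ FockF :=
  Submodule.span ℂ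
    {x | ∃ L : List BCIndex, chargeOf L = l ∧ x = (L.map fun i => ι ℂ (bv i)).prod}

/-- `F̄^l = {x ∈ F^l : c(0)x = 0}`. -/
def FFbar (l : ℤ) : Submodule ℂ FockF := FF l ⊓ LinearMap.ker (cOp 0)

/-- The anticommutator of a contraction and an exterior multiplication is the pairing. -/
lemma contractLeft_ι_mul_add (d : Module.Dual ℂ BCSpace) (v : BCSpace) (x : FockF) :
    CliffordAlgebra.contractLeft d (ι ℂ v * x) + ι ℂ v * CliffordAlgebra.contractLeft d x
      = d v • x := by
  have h := CliffordAlgebra.contractLeft_ι_mul (Q := (0 : QuadraticForm ℂ BCSpace)) d v x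
  exact (congrArg (· + _) h).trans (sub_add_cancel _ _)

lemma ι_mul_ι_mul_add_swap (v w : BCSpace) (x : FockF) :
    ι ℂ v * (ι ℂ w * x) + ι ℂ w * (ι ℂ v * x) = 0 := by
  rw [← mul_assoc, ← mul_assoc, ← add_mul, ExteriorAlgebra.ι_add_mul_swap, zero_mul]

lemma contractLeft_contractLeft_add_swap (d e : Module.Dual ℂ BCSpace) (x : FockF) :
    CliffordAlgebra.contractLeft d (CliffordAlgebra.contractLeft e x)
      + CliffordAlgebra.contractLeft e (CliffordAlgebra.contractLeft d x) = 0 := by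
  rw [CliffordAlgebra.contractLeft_comm, neg_add_cancel]

lemma bOp_bOp_add_swap (m n : ℤ) (x : FockF) :
    bOp m (bOp n x) + bOp n (bOp m x) = 0 := by
  unfold bOp
  split_ifs
  · exact ι_mul_ι_mul_add_swap _ _ _
  · rw [add_comm]
    refine (contractLeft_ι_mul_add _ _ _).trans ?_
    simp [bvDual, bv]
  · refine (contractLeft_ι_mul_add _ _ _).trans ?_
    simp [bvDual, bv]
  · exact contractLeft_contractLeft_add_swap _ _ _

lemma cOp_cOp_add_swap (m n : ℤ) (x : FockF) :
    cOp m (cOp n x) + cOp n (cOp m x) = 0 := by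
  unfold cOp
  split_ifs
  · exact contractLeft_contractLeft_add_swap _ _ _
  · refine (contractLeft_ι_mul_add _ _ _).trans ?_
    simp [bvDual, bv]
  · rw [add_comm]
    refine (contractLeft_ι_mul_add _ _ _).trans ?_
    simp [bvDual, bv]
  · exact ι_mul_ι_mul_add_swap _ _ _

lemma bOp_cOp_add_swap (m n : ℤ) (x : FockF) :
    bOp m (cOp n x) + cOp n (bOp m x) = if m + n = 0 then x else 0 := by
  unfold bOp cOp
  split_ifs with h₁ h₂ h₃ h₃ h₂ h₃ h₃
  · rw [add_comm]
    refine (contractLeft_ι_mul_add _ _ _).trans ?_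
    have : (-m).toNat = n.toNat := by omega
    simp [bvDual, bv, this]
  · rw [add_comm]
    refine (contractLeft_ι_mul_add _ _ _).trans ?_
    have : (-m).toNat ≠ n.toNat := by omega
    simp [bvDual, bv, this]
  · omega
  · exact ι_mul_ι_mul_add_swap _ _ _
  · omega
  · exact contractLeft_contractLeft_add_swap _ _ _
  · refine (contractLeft_ι_mul_add _ _ _).trans ?_
    have : (-n - 1).toNat = (m - 1).toNat := by omega
    simp [bvDual, bv, this]
  · refine (contractLeft_ι_mul_add _ _ _).trans ?_
    have : (-n - 1).toNat ≠ (m - 1).toNat := by omega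
    rw [bvDual, bv, Finsupp.lapply_apply,
      Finsupp.single_eq_of_ne' (Sum.inr_injective.ne this), zero_smul]

lemma exists_forall_contractLeft_eq_zero (x : FockF) :
    ∃ s : Finset BCIndex, ∀ i ∉ s, CliffordAlgebra.contractLeft (bvDual i) x = 0 := by
  classical
  induction x using CliffordAlgebra.left_induction with
  | algebraMap r => exact ⟨∅, fun i _ => CliffordAlgebra.contractLeft_algebraMap _ _ r⟩
  | add x y hx hy =>
    obtain ⟨s, hs⟩ := hx
    obtain ⟨t, ht⟩ := hy
    refine ⟨s ∪ t, fun i hi => ?_⟩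
    rw [Finset.notMem_union] at hi
    rw [map_add, hs i hi.1, ht i hi.2, add_zero]
  | ι_mul x v hx =>
    obtain ⟨s, hs⟩ := hx
    refine ⟨s ∪ v.support, fun i hi => ?_⟩
    rw [Finset.notMem_union, Finsupp.notMem_support_iff] at hi
    have hv : bvDual i v = 0 := hi.2
    rw [CliffordAlgebra.contractLeft_ι_mul, hs i hi.1, hv, zero_smul, mul_zero, sub_zero]

lemma exists_forall_ge_annihilate (x : FockF) :
    ∃ N : ℤ, ∀ n ≥ N, bOp n x = 0 ∧ cOp n x = 0 := by
  obtain ⟨s, hs⟩ := exists_forall_contractLeft_eq_zero x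
  refine ⟨s.sup (Sum.elim id id) + 2, fun n hn => ?_⟩
  have key : ∀ i ∈ s, Sum.elim id id i ≤ s.sup (Sum.elim id id) := fun i hi => Finset.le_sup hi
  constructor
  · rw [bOp, if_neg (by omega)]
    refine hs _ fun h => ?_
    have := key _ h
    simp only [Sum.elim_inr, id_eq] at this
    omega
  · rw [cOp, if_pos (by omega)]
    refine hs _ fun h => ?_
    have := key _ h
    simp only [Sum.elim_inl, id_eq] at this
    omega

lemma finite_support_smul_nbc (a : ℤ → ℂ) (m : ℤ) (x : FockF) :
    (Function.support fun k : ℤ => a k • nbc k (m - k) x).Finite := by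
  obtain ⟨N, hN⟩ := exists_forall_ge_annihilate x
  refine (Set.finite_Icc (m - |N|) (|N| + |m| + 1)).subset fun k hk => ?_
  by_contra hk'
  apply hk
  have hN' := le_abs_self N
  have hm := le_abs_self m
  have h0 := abs_nonneg N
  have h0' := abs_nonneg m
  rw [Set.mem_Icc, not_and_or, not_le, not_le] at hk'
  have : nbc k (m - k) x = 0 := by
    rcases hk' with h | h
    · rw [nbc, if_neg (by omega), LinearMap.comp_apply, (hN _ (by omega)).2, map_zero]
    · rw [nbc, if_pos (by omega), LinearMap.neg_apply, LinearMap.comp_apply,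
        (hN _ (by omega)).1, map_zero, neg_zero]
  simp only [this, smul_zero]

/-- The Virasoro mode `L_m` as a linear operator. -/
def LmodeHom (m : ℤ) : Module.End ℂ FockF where
  toFun := Lmode m
  map_add' x y := by
    simp only [Lmode, map_add, smul_add]
    exact finsum_add_distrib (finite_support_smul_nbc _ m x) (finite_support_smul_nbc _ m y)
  map_smul' r x := by
    simp only [Lmode, map_smul, RingHom.id_apply]
    rw [smul_finsum' r (finite_support_smul_nbc _ m x)]
    exact finsum_congr fun k => smul_comm _ _ _

lemma map_Lmode (f : Module.End ℂ FockF) (m : ℤ) (x : FockF) :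
    f (Lmode m x) = ∑ᶠ k : ℤ, (-k : ℂ) • f (nbc k (m - k) x) := by
  rw [Lmode, map_finsum f (finite_support_smul_nbc _ m x)]
  simp only [map_smul]

lemma finite_support_smul_map_nbc (f : Module.End ℂ FockF) (a : ℤ → ℂ) (m : ℤ) (x : FockF) :
    (Function.support fun k : ℤ => a k • f (nbc k (m - k) x)).Finite := by
  refine (finite_support_smul_nbc a m x).subset fun k hk h => hk ?_
  simp only [← map_smul] at h ⊢
  rw [h, map_zero]

lemma Lmode_map_sub (f : Module.End ℂ FockF) (m : ℤ) (x : FockF) :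
    Lmode m (f x) - f (Lmode m x)
      = ∑ᶠ k : ℤ, (-k : ℂ) • (nbc k (m - k) (f x) - f (nbc k (m - k) x)) := by
  rw [map_Lmode]
  simp only [smul_sub]
  exact (finsum_sub_distrib (finite_support_smul_nbc _ m (f x))
    (finite_support_smul_map_nbc f _ m x)).symm

lemma bOp_cOp_eq_nbc_add (k j : ℤ) (x : FockF) :
    bOp k (cOp j x) = nbc k j x + if k + j = 0 ∧ 1 ≤ k then x else 0 := by
  have h := bOp_cOp_add_swap k j x
  rw [nbc]
  by_cases h₁ : 1 ≤ k ∧ j ≤ -1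
  · rw [if_pos h₁, LinearMap.neg_apply, LinearMap.comp_apply]
    simp only [h₁.1, and_true, ← h]
    abel
  · rw [if_neg h₁, if_neg (by omega), add_zero, LinearMap.comp_apply]

/-- Normal ordering changes `b(k)c(j)` by a scalar, hence does not affect commutators. -/
lemma nbc_map_sub (f : Module.End ℂ FockF) (k j : ℤ) (x : FockF) :
    nbc k j (f x) - f (nbc k j x) = bOp k (cOp j (f x)) - f (bOp k (cOp j x)) := by
  rw [bOp_cOp_eq_nbc_add, bOp_cOp_eq_nbc_add, map_add]
  split_ifs
  · abel
  · simp

lemma Lmode_bOp (m n : ℤ) (x : FockF) :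
    Lmode m (bOp n x) = bOp n (Lmode m x) - ((m : ℂ) + n) • bOp (m + n) x := by
  have key : ∀ k : ℤ, nbc k (m - k) (bOp n x) - bOp n (nbc k (m - k) x)
      = if k = m + n then bOp k x else 0 := fun k => by
    have h₁ := bOp_bOp_add_swap k n (cOp (m - k) x)
    have h₂ := congrArg (bOp k) (bOp_cOp_add_swap n (m - k) x)
    rw [map_add, apply_ite (bOp k), map_zero] at h₂
    rw [nbc_map_sub, eq_neg_of_add_eq_zero_right h₁, sub_neg_eq_add, add_comm, h₂]
    exact if_congr (by omega) rfl rfl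
  rw [sub_eq_add_neg, ← sub_eq_iff_eq_add', Lmode_map_sub,
    finsum_eq_single _ (m + n) fun k hk => by rw [key, if_neg hk, smul_zero],
    key, if_pos rfl, ← neg_smul]
  push_cast
  rfl

lemma Lmode_cOp (m n : ℤ) (x : FockF) :
    Lmode m (cOp n x) = cOp n (Lmode m x) - (n : ℂ) • cOp (m + n) x := by
  have key : ∀ k : ℤ, nbc k (m - k) (cOp n x) - cOp n (nbc k (m - k) x)
      = if k = -n then -cOp (m - k) x else 0 := fun k => by
    have h₁ := congrArg (bOp k) (cOp_cOp_add_swap (m - k) n x)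
    have h₂ := bOp_cOp_add_swap k n (cOp (m - k) x)
    rw [map_add, map_zero] at h₁
    rw [nbc_map_sub, eq_neg_of_add_eq_zero_left h₁, ← neg_add', h₂, apply_ite Neg.neg, neg_zero]
    exact if_congr (by omega) rfl rfl
  rw [sub_eq_add_neg, ← sub_eq_iff_eq_add', Lmode_map_sub,
    finsum_eq_single _ (-n) fun k hk => by rw [key, if_neg hk, smul_zero],
    key, if_pos rfl, smul_neg, sub_neg_eq_add]
  push_cast
  rw [neg_neg]

lemma Lmode_nbc_sub (m k j : ℤ) (x : FockF) :
    Lmode m (nbc k j x) - nbc k j (Lmode m x)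
      = -(((m : ℂ) + k) • bOp (m + k) (cOp j x) + (j : ℂ) • bOp k (cOp (m + j) x)) := by
  have h : nbc k j (Lmode m x) - Lmode m (nbc k j x)
      = bOp k (cOp j (Lmode m x)) - Lmode m (bOp k (cOp j x)) := nbc_map_sub (LmodeHom m) k j x
  rw [← neg_sub, h, Lmode_bOp, Lmode_cOp, map_sub, map_smul]
  abel

lemma Lmode_Lmode_sub (m n : ℤ) (x : FockF) :
    Lmode m (Lmode n x) - Lmode n (Lmode m x)
      = ∑ᶠ k : ℤ, (((k : ℂ) * (m + k)) • bOp (m + k) (cOp (n - k) x)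
          + ((k : ℂ) * (n - k)) • bOp k (cOp (m + n - k) x)) := by
  have h := Lmode_map_sub (LmodeHom m) n x
  change Lmode n (Lmode m x) - Lmode m (Lmode n x)
    = ∑ᶠ k : ℤ, (-k : ℂ) • (nbc k (n - k) (Lmode m x) - Lmode m (nbc k (n - k) x)) at h
  rw [← neg_sub, h, ← finsum_neg_distrib]
  refine finsum_congr fun k => ?_
  rw [← neg_sub (Lmode m _), Lmode_nbc_sub, neg_neg, neg_smul, neg_neg, smul_add, smul_smul,
    smul_smul, add_sub_assoc]
  push_cast
  rfl

/-- The central term coming from reordering the summands of `[L_m, L_{-m}]`. -/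
def anomaly (m k : ℤ) : ℂ :=
  (k : ℂ) * (m + k) * ((if 1 ≤ m + k then 1 else 0) - if 1 ≤ k then 1 else 0)

lemma finite_support_anomaly (m : ℤ) : (Function.support (anomaly m)).Finite := by
  refine (Set.finite_Icc (-|m|) (|m| + 1)).subset fun k hk => ?_
  by_contra hk'
  apply hk
  have hm := le_abs_self m
  have hm' := neg_abs_le m
  rw [Set.mem_Icc, not_and_or, not_le, not_le] at hk'
  unfold anomaly
  rcases hk' with h | h
  · rw [if_neg (by omega), if_neg (by omega), sub_zero, mul_zero]
  · rw [if_pos (by omega), if_pos (by omega), sub_self, mul_zero]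

lemma anomaly_neg (m k : ℤ) : anomaly (-m) k = -anomaly m (k - m) := by
  have h₁ : m + (k - m) = k := by ring
  have h₂ : -m + k = k - m := by ring
  simp only [anomaly, h₁, h₂]
  push_cast
  ring

lemma sum_range_neg_mul_sub (a : ℂ) (q : ℕ) :
    ∑ i ∈ Finset.range q, -(i : ℂ) * (a - i)
      = -(a * (q * (q - 1) / 2)) + (q - 1) * q * (2 * q - 1) / 6 := by
  induction q with
  | zero => simp
  | succ q ih =>
    rw [Finset.sum_range_succ, ih]
    push_cast
    ring

lemma finsum_anomaly_natCast (p : ℕ) :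
    ∑ᶠ k, anomaly p k = -((1 / 6 : ℂ) * ((p : ℂ) ^ 3 - p)) := by
  have hinj : Set.InjOn (fun i : ℕ => -(i : ℤ)) (Finset.range p) := fun i _ j _ h => by
    simpa using h
  rw [finsum_eq_sum_of_support_subset (s := (Finset.range p).image fun i : ℕ => -(i : ℤ)),
    Finset.sum_image hinj]
  · have : ∀ i ∈ Finset.range p, anomaly p (-(i : ℤ)) = -(i : ℂ) * (p - i) := fun i hi => by
      rw [Finset.mem_range] at hi
      rw [anomaly, if_pos (by omega), if_neg (by omega)]
      push_cast
      ring
    rw [Finset.sum_congr rfl this, sum_range_neg_mul_sub]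
    ring
  · intro k hk
    by_contra hk'
    apply hk
    unfold anomaly
    by_cases h : 1 ≤ k
    · rw [if_pos (by omega), if_pos h, sub_self, mul_zero]
    · have : ¬ 1 ≤ (p : ℤ) + k := fun h' => hk' <| by
        rw [Finset.coe_image]
        exact ⟨k.natAbs, by simp only [Finset.coe_range, Set.mem_Iio]; omega, by simp only; omega⟩
      rw [if_neg this, if_neg h, sub_self, mul_zero]

lemma finsum_anomaly (m : ℤ) :
    ∑ᶠ k, anomaly m k = -((1 / 6 : ℂ) * ((m : ℂ) ^ 3 - m)) := by
  obtain ⟨p, rfl | rfl⟩ := m.eq_nat_or_neg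
  · exact_mod_cast finsum_anomaly_natCast p
  · simp only [anomaly_neg]
    have hshift : ∑ᶠ k, anomaly p (k - p) = ∑ᶠ k, anomaly p k :=
      finsum_comp_equiv (Equiv.subRight (p : ℤ))
    rw [finsum_neg_distrib, hshift, finsum_anomaly_natCast]
    push_cast
    ring

/-- The modes of `T(z) = :∂b(z)c(z):` satisfy the Virasoro relations with
central charge `−2`. -/
theorem virasoro_relations_central_charge_neg_two (m n : ℤ) (x : FockF) :
    Lmode m (Lmode n x) - Lmode n (Lmode m x)
      = ((m : ℂ) - (n : ℂ)) • Lmode (m + n) x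
        - ((1 / 6 : ℂ) * ((m : ℂ) ^ 3 - (m : ℂ))) • (if m = -n then x else 0) := by
  have hA : (Function.support fun k : ℤ =>
      (((k - m : ℤ) : ℂ) * k) • nbc k (m + n - k) x).Finite := finite_support_smul_nbc _ _ _
  have hA' : (Function.support fun k : ℤ =>
      ((k : ℂ) * (m + k)) • nbc (m + k) (n - k) x).Finite := by
    refine (hA.preimage (Equiv.addLeft m).injective.injOn).subset fun k hk => ?_
    have h : m + n - (m + k) = n - k := by ring
    simpa [h] using hk
  have hB : (Function.support fun k : ℤ =>
      ((k : ℂ) * (n - k)) • nbc k (m + n - k) x).Finite := finite_support_smul_nbc _ _ _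
  have hC : (Function.support fun k : ℤ =>
      anomaly m k • (if m = -n then x else 0)).Finite :=
    (finite_support_anomaly m).subset fun k hk h => hk (by simp only [h, zero_smul])
  have hAA' : ∑ᶠ k : ℤ, ((k : ℂ) * (m + k)) • nbc (m + k) (n - k) x
      = ∑ᶠ k : ℤ, (((k - m : ℤ) : ℂ) * k) • nbc k (m + n - k) x := by
    refine (finsum_congr fun k => ?_).trans (finsum_comp_equiv (Equiv.addLeft m))
    have h : m + n - (m + k) = n - k := by ring
    simp [h]
  have hsplit : ∀ k : ℤ, ((k : ℂ) * (m + k)) • bOp (m + k) (cOp (n - k) x)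
          + ((k : ℂ) * (n - k)) • bOp k (cOp (m + n - k) x)
      = ((k : ℂ) * (m + k)) • nbc (m + k) (n - k) x
        + ((k : ℂ) * (n - k)) • nbc k (m + n - k) x
        + anomaly m k • (if m = -n then x else 0) := fun k => by
    rw [bOp_cOp_eq_nbc_add, bOp_cOp_eq_nbc_add]
    by_cases h : m = -n
    · have h₁ : m + k + (n - k) = 0 := by omega
      have h₂ : k + (m + n - k) = 0 := by omega
      have h₃ : (n : ℂ) = -m := by rw [h]; push_cast; ring
      simp only [h₁, h₂, true_and, if_pos h, anomaly, h₃]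
      split_ifs <;> module
    · have h₁ : ¬ m + k + (n - k) = 0 := by omega
      have h₂ : ¬ k + (m + n - k) = 0 := by omega
      simp only [h₁, h₂, false_and, if_neg h, if_false, smul_zero, add_zero]
  rw [Lmode_Lmode_sub, finsum_congr hsplit,
    finsum_add_distrib ((hA'.union hB).subset (Function.support_add _ _)) hC,
    finsum_add_distrib hA' hB, hAA', ← finsum_add_distrib hA hB,
    ← finsum_smul' (finite_support_anomaly m), finsum_anomaly, neg_smul, ← sub_eq_add_neg, Lmode,
    smul_finsum' _ (finite_support_smul_nbc _ _ _)]
  congr 1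
  refine finsum_congr fun k => ?_
  push_cast
  module
end
end

section
/- Let F be the fermionic Fock space of the bc-system with the operators L_m, W̃_m, c(0) and subspaces F^l, F̄^l defined in the context. For every l ∈ ℤ: (i) c(0) ∘ L_m = L_m ∘ c(0) and c(0) ∘ W̃_m = W̃_m ∘ c(0) for all m ∈ ℤ; (ii) c(0) maps F^l onto F̄^{l−1}, and its kernel in F^l is exactly F̄^l. Thus 0 → F̄^l → F^l → F̄^{l−1} → 0 is a short exact sequence of vector spaces in which all maps commute with every L_m and W̃_m. -/
noncomputable section

open ExteriorAlgebra

open CliffordAlgebra in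
/-- Only finitely many of the basis contractions act nontrivially on a given `x`. -/
theorem finite_contractLeft_ne_zero (x : FockF) :
    {i : BCIndex | contractLeft (Q := (0 : QuadraticForm ℂ BCSpace)) (bvDual i) x ≠ 0}.Finite := by
  induction x using CliffordAlgebra.left_induction with
  | algebraMap r => simp [contractLeft_algebraMap]
  | add x y hx hy =>
    refine (hx.union hy).subset fun i hi => ?_
    by_contra h
    simp only [Set.mem_union, Set.mem_ofPred_eq, not_or, not_not] at h
    exact hi (by rw [map_add, h.1, h.2, add_zero])
  | ι_mul x v hx =>
    refine (v.hasFiniteSupport.union hx).subset fun i hi => ?_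
    by_contra h
    simp only [Set.mem_union, Function.mem_support, Set.mem_ofPred_eq, not_or, not_not] at h
    refine hi ?_
    have hv : bvDual i v = 0 := h.1
    rw [contractLeft_ι_mul, h.2, hv, zero_smul, mul_zero, sub_zero]

theorem finite_nbc_apply_ne_zero (m : ℤ) (x : FockF) :
    {k : ℤ | nbc k (m - k) x ≠ 0}.Finite := by
  have hx := finite_contractLeft_ne_zero x
  have hw : {k : ℤ | 1 ≤ k ∧ CliffordAlgebra.contractLeft (Q := (0 : QuadraticForm ℂ BCSpace))
      (bvDual (Sum.inr (k - 1).toNat)) x ≠ 0}.Finite := by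
    refine Set.Finite.of_finite_image (f := fun k : ℤ => (Sum.inr (k - 1).toNat : BCIndex))
      (hx.subset ?_) fun a ha b hb hab => ?_
    · rintro _ ⟨k, hk, rfl⟩
      exact hk.2
    · have h := Sum.inr_injective hab
      have := ha.1
      have := hb.1
      omega
  have hv : {k : ℤ | 0 ≤ m - k ∧ CliffordAlgebra.contractLeft (Q := (0 : QuadraticForm ℂ BCSpace))
      (bvDual (Sum.inl (m - k).toNat)) x ≠ 0}.Finite := by
    refine Set.Finite.of_finite_image (f := fun k : ℤ => (Sum.inl (m - k).toNat : BCIndex))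
      (hx.subset ?_) fun a ha b hb hab => ?_
    · rintro _ ⟨k, hk, rfl⟩
      exact hk.2
    · have h := Sum.inl_injective hab
      have := ha.1
      have := hb.1
      omega
  refine ((hw.union hv).union (Set.finite_Ioc m 0)).subset fun k hk => ?_
  rw [Set.mem_ofPred_eq, nbc] at hk
  split_ifs at hk with h
  · refine Or.inl (Or.inl ⟨h.1, fun h0 => hk ?_⟩)
    have hb : bOp k x = 0 := by rw [bOp, if_neg (by omega)]; exact h0
    simp [hb]
  · by_cases hm : 0 ≤ m - k
    · refine Or.inl (Or.inr ⟨hm, fun h0 => hk ?_⟩)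
      have hc : cOp (m - k) x = 0 := by rw [cOp, if_pos hm]; exact h0
      simp [hc]
    · exact Or.inr ⟨by omega, by omega⟩

theorem cOp_zero_apply (x : FockF) :
    cOp 0 x = CliffordAlgebra.contractLeft (bvDual (Sum.inl 0)) x := by
  simp [cOp]

theorem cOp_zero_ι_mul (v : BCSpace) (x : FockF) :
    cOp 0 (ι ℂ v * x) = v (Sum.inl 0) • x - ι ℂ v * cOp 0 x := by
  simp only [cOp_zero_apply]
  exact CliffordAlgebra.contractLeft_ι_mul _ _ _

theorem cOp_zero_cOp_zero (x : FockF) : cOp 0 (cOp 0 x) = 0 := by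
  simp only [cOp_zero_apply]
  exact CliffordAlgebra.contractLeft_contractLeft _ _

theorem cOp_zero_cOp (j : ℤ) (x : FockF) : cOp 0 (cOp j x) = -cOp j (cOp 0 x) := by
  by_cases hj : 0 ≤ j
  · have h (y : FockF) : cOp j y = CliffordAlgebra.contractLeft (bvDual (Sum.inl j.toNat)) y := by
      rw [cOp, if_pos hj]
    rw [h, h, cOp_zero_apply, cOp_zero_apply]
    exact CliffordAlgebra.contractLeft_comm _ _ _
  · have h (y : FockF) : cOp j y = ι ℂ (bv (Sum.inr (-j - 1).toNat)) * y := by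
      rw [cOp, if_neg hj, LinearMap.mulLeft_apply]
    rw [h, h, cOp_zero_ι_mul]
    simp [bv]

theorem cOp_zero_bOp {k : ℤ} (hk : k ≠ 0) (x : FockF) :
    cOp 0 (bOp k x) = -bOp k (cOp 0 x) := by
  by_cases h0 : k ≤ 0
  · have h (y : FockF) : bOp k y = ι ℂ (bv (Sum.inl (-k).toNat)) * y := by
      rw [bOp, if_pos h0, LinearMap.mulLeft_apply]
    have hne : (-k).toNat ≠ 0 := by omega
    rw [h, h, cOp_zero_ι_mul]
    simp [bv, hne]
  · have h (y : FockF) :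
        bOp k y = CliffordAlgebra.contractLeft (bvDual (Sum.inr (k - 1).toNat)) y := by
      rw [bOp, if_neg h0]
    rw [h, h, cOp_zero_apply, cOp_zero_apply]
    exact CliffordAlgebra.contractLeft_comm _ _ _

theorem cOp_zero_nbc {k : ℤ} (hk : k ≠ 0) (j : ℤ) (x : FockF) :
    cOp 0 (nbc k j x) = nbc k j (cOp 0 x) := by
  unfold nbc
  split_ifs <;> simp [cOp_zero_bOp hk, cOp_zero_cOp]

/-- `c(0)` commutes with every mode of a normally ordered series without a `b(0)` term. -/
theorem cOp_zero_finsum_nbc (a : ℤ → ℂ) (ha : a 0 = 0) (m : ℤ) (x : FockF) :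
    cOp 0 (∑ᶠ k : ℤ, a k • nbc k (m - k) x) = ∑ᶠ k : ℤ, a k • nbc k (m - k) (cOp 0 x) := by
  rw [map_finsum]
  · refine finsum_congr fun k => ?_
    rcases eq_or_ne k 0 with rfl | hk
    · simp [ha]
    · rw [map_smul, cOp_zero_nbc hk]
  · exact (finite_nbc_apply_ne_zero m x).subset fun k hk h => hk (by simp [h])

theorem chargeOf_cons (i : BCIndex) (L : List BCIndex) :
    chargeOf (i :: L) = chargeOf [i] + chargeOf L := by
  simp only [chargeOf, List.countP_cons, List.countP_nil]
  push_cast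
  ring

theorem ι_bv_mul_mem_FF (i : BCIndex) {l : ℤ} {x : FockF} (hx : x ∈ FF l) :
    ι ℂ (bv i) * x ∈ FF (chargeOf [i] + l) := by
  have h : FF l ≤ (FF (chargeOf [i] + l)).comap (LinearMap.mulLeft ℂ (ι ℂ (bv i))) := by
    refine Submodule.span_le.2 ?_
    rintro _ ⟨L, hL, rfl⟩
    exact Submodule.subset_span ⟨i :: L, by rw [chargeOf_cons, hL], by simp⟩
  exact h hx

theorem cOp_zero_prod_mem_FF (L : List BCIndex) :
    cOp 0 (L.map fun i => ι ℂ (bv i)).prod ∈ FF (chargeOf L - 1) := by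
  induction L with
  | nil => simp [cOp_zero_apply]
  | cons i L ih =>
    rw [List.map_cons, List.prod_cons, cOp_zero_ι_mul]
    refine Submodule.sub_mem _ ?_ ?_
    · by_cases hi : i = Sum.inl 0
      · subst hi
        refine Submodule.smul_mem _ _ (Submodule.subset_span ⟨L, ?_, rfl⟩)
        rw [chargeOf_cons]
        simp [chargeOf]
      · simp [bv, hi]
    · rw [chargeOf_cons, add_sub_assoc]
      exact ι_bv_mul_mem_FF i ih

theorem cOp_zero_mem_FF {l : ℤ} {x : FockF} (hx : x ∈ FF l) : cOp 0 x ∈ FF (l - 1) := by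
  have h : FF l ≤ (FF (l - 1)).comap (cOp 0) := by
    refine Submodule.span_le.2 ?_
    rintro _ ⟨L, rfl, rfl⟩
    exact cOp_zero_prod_mem_FF L
  exact h hx

theorem map_cOp_zero_FF (l : ℤ) : Submodule.map (cOp 0) (FF l) = FFbar (l - 1) := by
  refine le_antisymm ?_ fun x hx => ?_
  · rintro _ ⟨x, hx, rfl⟩
    exact ⟨cOp_zero_mem_FF hx, cOp_zero_cOp_zero x⟩
  · have hc : cOp 0 x = 0 := hx.2
    refine ⟨ι ℂ (bv (Sum.inl 0)) * x, ?_, ?_⟩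
    · simpa [chargeOf] using ι_bv_mul_mem_FF (Sum.inl 0) hx.1
    · rw [cOp_zero_ι_mul, hc]
      simp [bv]

/-- `c(0)` commutes with all `L_m` and `W̃_m`, maps `F^l` onto `F̄^{l−1}`, and its
kernel in `F^l` is exactly `F̄^l`; this gives the short exact sequence
`0 → F̄^l → F^l → F̄^{l−1} → 0` of modules over the `W_3` algebra with central
charge `−2`. -/
theorem c0_exact_sequence (l : ℤ) :
    (∀ (m : ℤ) (x : FockF), cOp 0 (Lmode m x) = Lmode m (cOp 0 x)) ∧
    (∀ (m : ℤ) (x : FockF), cOp 0 (Wmode m x) = Wmode m (cOp 0 x)) ∧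
    Submodule.map (cOp 0) (FF l) = FFbar (l - 1) ∧
    FF l ⊓ LinearMap.ker (cOp 0) = FFbar l := by
  exact ⟨fun m x => cOp_zero_finsum_nbc (fun k => -k) (by simp) m x,
    fun m x => cOp_zero_finsum_nbc (fun k => (1 / 2 : ℂ) * k * (2 * k - m)) (by simp) m x,
    map_cOp_zero_FF l, rfl⟩
end
end
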